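/- arXiv:1104.3419 — 4 statements merged into one kernel-verified Lean document; each statement's English description precedes it below -/
import Mathlib

section
/- Let z ≥ 2 be an integer, let λ be a real number with 1 < λ < 2, let E > 0 and s > 0 be real numbers, and set μ := 1/(λ−1). Then the sequence T_k := (E/s)·(2·μ^(k−1) − λ)/(2·μ^z − λ), for k = 1, …, z, satisfies the optimality system of equations: (1/λ)·(E + s·T_z) = E − s·T_1; (λ+1)·T_1 = (λ−1)·T_2; and, for every k = 1, …, z−2, (1/(λ−1))·(λ·T_{k+1} − T_k) = T_{k+2}. -/
/-- Existence part of the main theorem on optimal threshold locations: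
the closed-form thresholds `T k = (E/s)·(2·μ^(k-1) − λ)/(2·μ^z − λ)` satisfy
the optimality system of equations. -/
theorem optimal_thresholds_satisfy_system
    (z : ℕ) (hz : 2 ≤ z) (lam E s : ℝ) (hlam1 : 1 < lam) (hlam2 : lam < 2)
    (hE : 0 < E) (hs : 0 < s)
    (mu : ℝ) (hmu : mu = 1 / (lam - 1))
    (T : ℕ → ℝ)
    (hT : ∀ k, 1 ≤ k → k ≤ z →
      T k = (E / s) * (2 * mu ^ (k - 1) - lam) / (2 * mu ^ z - lam)) :
    (1 / lam) * (E + s * T z) = E - s * T 1 ∧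
    (lam + 1) * T 1 = (lam - 1) * T 2 ∧
    (∀ k, 1 ≤ k → k ≤ z - 2 →
      (1 / (lam - 1)) * (lam * T (k + 1) - T k) = T (k + 2)) := by
  have hlam : lam - 1 ≠ 0 := by linarith
  have hlam0 : lam ≠ 0 := by linarith
  have hmul : mu * (lam - 1) = 1 := by rw [hmu]; field_simp
  have hmu1 : 1 ≤ mu := by
    rw [hmu, le_div_iff₀ (by linarith)]
    linarith
  have hD : 2 * mu ^ z - lam ≠ 0 := by
    have := one_le_pow₀ hmu1 (n := z)
    linarith
  obtain ⟨c, hc⟩ : ∃ c, c = E / s / (2 * mu ^ z - lam) := ⟨_, rfl⟩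
  have hcE : s * c * (2 * mu ^ z - lam) = E := by
    rw [hc]
    field_simp
  have hT' : ∀ k, k + 1 ≤ z → T (k + 1) = c * (2 * mu ^ k - lam) := by
    intro k hk
    rw [hT (k + 1) (by omega) hk, hc, Nat.add_sub_cancel]
    ring
  rw [← hmu]
  refine ⟨?_, ?_, ?_⟩
  · obtain ⟨n, rfl⟩ : ∃ n, z = n + 1 := ⟨z - 1, by omega⟩
    rw [hT' n le_rfl, hT' 0 (by omega), one_div, inv_mul_eq_iff_eq_mul₀ hlam0, ← hcE]
    linear_combination (-2 * s * c * mu ^ n) * hmul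
  · rw [hT' 0 (by omega), hT' 1 (by omega)]
    linear_combination (-2 * c) * hmul
  · intro k hk hkz
    obtain ⟨n, rfl⟩ : ∃ n, k = n + 1 := ⟨k - 1, by omega⟩
    rw [hT' (n + 1) (by omega), hT' n (by omega), hT' (n + 2) (by omega)]
    linear_combination (c * (2 * mu ^ (n + 1) - lam)) * hmul
end

section
/- Let z ≥ 2 be an integer, let λ be a real number with 1 < λ < 2, let E > 0 and s > 0 be real numbers, and set μ := 1/(λ−1). If real numbers T_1, …, T_z satisfy the optimality system of equations (1/λ)·(E + s·T_z) = E − s·T_1; (λ+1)·T_1 = (λ−1)·T_2; and (1/(λ−1))·(λ·T_{k+1} − T_k) = T_{k+2} for every k = 1, …, z−2, then necessarily T_k = (E/s)·(2·μ^(k−1) − λ)/(2·μ^z − λ) for every k = 1, …, z. -/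
/-- A solution of the optimality recurrence is determined by its first value. -/
theorem threshold_recurrence_closed_form {z : ℕ} {lam mu : ℝ} (hmul : mu * (lam - 1) = 1)
    {T : ℕ → ℝ} (h2 : (lam + 1) * T 1 = (lam - 1) * T 2)
    (h3 : ∀ k, 1 ≤ k → k ≤ z - 2 → mu * (lam * T (k + 1) - T k) = T (k + 2)) (k : ℕ) :
    k + 1 ≤ z → (2 - lam) * T (k + 1) = T 1 * (2 * mu ^ k - lam) := by
  induction k using Nat.twoStepInduction with
  | zero => intro _; simp only [zero_add, pow_zero]; ring
  | one =>
    intro _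
    simp only [Nat.reduceAdd, pow_one]
    linear_combination (-mu * (2 - lam)) * h2 + (-(2 - lam) * T 2 - lam * T 1) * hmul
  | more n ih₀ ih₁ =>
    intro hn
    have e := h3 (n + 1) (by omega) (by omega)
    have i₀ := ih₀ (by omega)
    have i₁ := ih₁ (by omega)
    simp only [pow_succ] at i₁ ⊢
    linear_combination (-(2 - lam)) * e + mu * lam * i₁ - mu * i₀ +
      T 1 * (2 * mu ^ n * mu - lam) * hmul

/-- Uniqueness part of the main theorem on optimal threshold locations:
any solution of the optimality system of equations equals the closed form
`T k = (E/s)·(2·μ^(k-1) − λ)/(2·μ^z − λ)`. -/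
theorem optimal_thresholds_unique
    (z : ℕ) (hz : 2 ≤ z) (lam E s : ℝ) (hlam1 : 1 < lam) (hlam2 : lam < 2)
    (hE : 0 < E) (hs : 0 < s)
    (mu : ℝ) (hmu : mu = 1 / (lam - 1))
    (T : ℕ → ℝ)
    (h1 : (1 / lam) * (E + s * T z) = E - s * T 1)
    (h2 : (lam + 1) * T 1 = (lam - 1) * T 2)
    (h3 : ∀ k, 1 ≤ k → k ≤ z - 2 →
      (1 / (lam - 1)) * (lam * T (k + 1) - T k) = T (k + 2)) :
    ∀ k, 1 ≤ k → k ≤ z →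
      T k = (E / s) * (2 * mu ^ (k - 1) - lam) / (2 * mu ^ z - lam) := by
  have hpos : 0 < lam - 1 := by linarith
  have hmul : mu * (lam - 1) = 1 := by rw [hmu]; field_simp
  have hmu1 : 1 ≤ mu := by
    rw [hmu, le_div_iff₀ hpos]
    linarith
  have hden : 2 * mu ^ z - lam ≠ 0 := by
    have := one_le_pow₀ hmu1 (n := z)
    linarith
  have closed := threshold_recurrence_closed_form hmul h2 (hmu ▸ h3)
  have hboundary : E + s * T z = lam * (E - s * T 1) := by
    rw [← h1]
    field_simp
  obtain ⟨m, rfl⟩ : ∃ m, z = m + 1 := ⟨z - 1, by omega⟩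
  have hz' := closed m le_rfl
  have hfirst : s * T 1 * (2 * mu ^ (m + 1) - lam) = E * (2 - lam) := by
    rw [pow_succ]
    linear_combination mu * (2 - lam) * hboundary - s * mu * hz' +
      (s * T 1 * lam + E * (2 - lam)) * hmul
  intro k hk hkz
  obtain ⟨n, rfl⟩ : ∃ n, k = n + 1 := ⟨k - 1, by omega⟩
  have hk' := closed n hkz
  rw [Nat.add_sub_cancel, eq_div_iff hden]
  have hlam : 2 - lam ≠ 0 := by linarith
  field_simp
  apply mul_left_cancel₀ hlam
  linear_combination s * (2 * mu ^ (m + 1) - lam) * hk' + (2 * mu ^ n - lam) * hfirst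
end

section
/- Let z ≥ 2 be an integer and let E > 0 and s > 0 be real numbers. Then the sequence T_k := E·(2k − 1)/(s·(2z + 1)), for k = 1, …, z, satisfies the optimality system of equations for λ = 2: (1/2)·(E + s·T_z) = E − s·T_1; 3·T_1 = T_2; and, for every k = 1, …, z−2, 2·T_{k+1} − T_k = T_{k+2}. Moreover, any real numbers T_1, …, T_z satisfying this system equal this closed form. -/
/-- A finite sequence with vanishing second differences and `T 2 = 3 * T 1` is proportional to
the odd numbers. -/
theorem eq_odd_mul_of_second_difference_eq_zero (z : ℕ) (T : ℕ → ℝ) (h₂ : 3 * T 1 = T 2)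
    (hrec : ∀ k : ℕ, 1 ≤ k → k ≤ z - 2 → 2 * T (k + 1) - T k = T (k + 2)) (k : ℕ)
    (hk : 1 ≤ k) (hkz : k ≤ z) : T k = (2 * (k : ℝ) - 1) * T 1 := by
  induction k using Nat.strong_induction_on with
  | _ k ih =>
    match k with
    | 1 => norm_num
    | 2 => rw [← h₂]; push_cast; ring
    | k + 3 =>
      rw [← hrec (k + 1) (by omega) (by omega), ih (k + 2) (by omega) (by omega) (by omega),
        ih (k + 1) (by omega) (by omega) (by omega)]
      push_cast
      ring

/-- The λ = 2 (outer BMD decoding) special case: the closed form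
`T k = E·(2k−1)/(s·(2z+1))` satisfies the optimality system, and every
solution of the system equals this closed form. -/
theorem optimal_thresholds_BMD
    (z : ℕ) (hz : 2 ≤ z) (E s : ℝ) (hE : 0 < E) (hs : 0 < s) :
    ((1 / 2 : ℝ) * (E + s * (E * (2 * (z : ℝ) - 1) / (s * (2 * (z : ℝ) + 1)))) =
        E - s * (E * (2 * (1 : ℝ) - 1) / (s * (2 * (z : ℝ) + 1))) ∧
      3 * (E * (2 * (1 : ℝ) - 1) / (s * (2 * (z : ℝ) + 1))) =
        E * (2 * (2 : ℝ) - 1) / (s * (2 * (z : ℝ) + 1)) ∧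
      ∀ k : ℕ, 1 ≤ k → k ≤ z - 2 →
        2 * (E * (2 * ((k : ℝ) + 1) - 1) / (s * (2 * (z : ℝ) + 1))) -
            E * (2 * (k : ℝ) - 1) / (s * (2 * (z : ℝ) + 1)) =
          E * (2 * ((k : ℝ) + 2) - 1) / (s * (2 * (z : ℝ) + 1))) ∧
    (∀ T : ℕ → ℝ,
      (1 / 2 : ℝ) * (E + s * T z) = E - s * T 1 →
      3 * T 1 = T 2 →
      (∀ k : ℕ, 1 ≤ k → k ≤ z - 2 → 2 * T (k + 1) - T k = T (k + 2)) →
      ∀ k : ℕ, 1 ≤ k → k ≤ z →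
        T k = E * (2 * (k : ℝ) - 1) / (s * (2 * (z : ℝ) + 1))) := by
  have hz' : 2 * (z : ℝ) + 1 ≠ 0 := by positivity
  refine ⟨⟨?_, ?_, fun k _ _ => ?_⟩, fun T h₁ h₂ hrec k hk hkz => ?_⟩
  · field_simp
    ring
  · ring
  · ring
  · have hT := eq_odd_mul_of_second_difference_eq_zero z T h₂ hrec
    rw [hT z (by omega) le_rfl] at h₁
    rw [hT k hk hkz, eq_div_iff (by positivity)]
    linear_combination 2 * (2 * (k : ℝ) - 1) * h₁
end

section
/- Fix integers z ≥ 1 and k with 1 ≤ k ≤ z. The function F(λ) := (2·(1/(λ−1))^(k−1) − λ)/(2·(1/(λ−1))^z − λ) is monotonically nondecreasing in λ on the interval 1 < λ < 2. Consequently, for fixed E > 0 and s > 0, the optimal threshold T_k = (E/s)·F(λ) is non-increasing as λ decreases. -/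
/-- The polynomial `1 + 2 (u + u² + ⋯ + uⁿ)`. -/
noncomputable def onePlusTwiceGeom (u : ℝ) (n : ℕ) : ℝ :=
  1 + 2 * ∑ i ∈ Finset.range n, u ^ (i + 1)

theorem onePlusTwiceGeom_succ (u : ℝ) (n : ℕ) :
    onePlusTwiceGeom u (n + 1) = onePlusTwiceGeom u n + 2 * u ^ (n + 1) := by
  simp only [onePlusTwiceGeom, Finset.sum_range_succ]
  ring

theorem onePlusTwiceGeom_pos {u : ℝ} (hu : 0 ≤ u) (n : ℕ) : 0 < onePlusTwiceGeom u n := by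
  unfold onePlusTwiceGeom
  positivity

theorem pow_mul_pow_le_pow_mul_pow {u v : ℝ} (hv : 0 ≤ v) (hvu : v ≤ u) {m n : ℕ}
    (hmn : m ≤ n) : u ^ m * v ^ n ≤ v ^ m * u ^ n := by
  obtain ⟨d, rfl⟩ := Nat.exists_eq_add_of_le hmn
  have hu : 0 ≤ u := hv.trans hvu
  calc u ^ m * v ^ (m + d) = (u ^ m * v ^ m) * v ^ d := by ring
    _ ≤ (u ^ m * v ^ m) * u ^ d := by gcongr
    _ = v ^ m * u ^ (m + d) := by ring

theorem onePlusTwiceGeom_mul_pow_le {u v : ℝ} (hv : 0 ≤ v) (hvu : v ≤ u) {m n : ℕ}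
    (hmn : m ≤ n) : onePlusTwiceGeom u m * v ^ n ≤ onePlusTwiceGeom v m * u ^ n := by
  induction m with
  | zero => simpa [onePlusTwiceGeom] using pow_le_pow_left₀ hv hvu n
  | succ m ih =>
    have h := ih (Nat.le_of_succ_le hmn)
    have h' := pow_mul_pow_le_pow_mul_pow hv hvu hmn
    rw [onePlusTwiceGeom_succ, onePlusTwiceGeom_succ]
    linarith

theorem onePlusTwiceGeom_mul_le {u v : ℝ} (hv : 0 ≤ v) (hvu : v ≤ u) {m n : ℕ} (hmn : m ≤ n) :
    onePlusTwiceGeom u m * onePlusTwiceGeom v n ≤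
      onePlusTwiceGeom v m * onePlusTwiceGeom u n := by
  induction n, hmn using Nat.le_induction with
  | base => rw [mul_comm]
  | succ n hmn ih =>
    have h := onePlusTwiceGeom_mul_pow_le hv hvu (hmn.trans (Nat.le_add_right n 1))
    rw [onePlusTwiceGeom_succ v, onePlusTwiceGeom_succ u]
    linarith

theorem two_mul_one_div_pow_sub {x : ℝ} (hx : 1 < x) (n : ℕ) :
    2 * (1 / (x - 1)) ^ n - x = (2 - x) * onePlusTwiceGeom (1 / (x - 1)) n := by
  have hx' : x - 1 ≠ 0 := by linarith
  induction n with
  | zero => simp [onePlusTwiceGeom]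
  | succ n ih =>
    have h : (x - 1) * (1 / (x - 1)) ^ (n + 1) = (1 / (x - 1)) ^ n := by
      rw [pow_succ]
      field_simp
    rw [onePlusTwiceGeom_succ, mul_add, ← ih, ← h]
    ring

theorem threshold_ratio_eq {x : ℝ} (hx : 1 < x) (hx2 : x < 2) (m n : ℕ) :
    (2 * (1 / (x - 1)) ^ m - x) / (2 * (1 / (x - 1)) ^ n - x) =
      onePlusTwiceGeom (1 / (x - 1)) m / onePlusTwiceGeom (1 / (x - 1)) n := by
  rw [two_mul_one_div_pow_sub hx, two_mul_one_div_pow_sub hx,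
    mul_div_mul_left _ _ (sub_pos.mpr hx2).ne']

/-- The threshold scaling factor
`F(λ) = (2·(1/(λ−1))^(k−1) − λ)/(2·(1/(λ−1))^z − λ)` is monotonically
nondecreasing in λ on (1, 2); consequently the optimal threshold
`T_k = (E/s)·F(λ)` is non-increasing as λ decreases. -/
theorem threshold_factor_monotone
    (z k : ℕ) (hz : 1 ≤ z) (hk1 : 1 ≤ k) (hkz : k ≤ z)
    (F : ℝ → ℝ)
    (hF : ∀ lam : ℝ, F lam =
      (2 * (1 / (lam - 1)) ^ (k - 1) - lam) / (2 * (1 / (lam - 1)) ^ z - lam)) :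
    (∀ lam₁ lam₂ : ℝ, 1 < lam₁ → lam₁ ≤ lam₂ → lam₂ < 2 → F lam₁ ≤ F lam₂) ∧
    (∀ E s : ℝ, 0 < E → 0 < s →
      ∀ lam₁ lam₂ : ℝ, 1 < lam₁ → lam₁ ≤ lam₂ → lam₂ < 2 →
        (E / s) * F lam₁ ≤ (E / s) * F lam₂) := by
  have hmono : ∀ lam₁ lam₂ : ℝ, 1 < lam₁ → lam₁ ≤ lam₂ → lam₂ < 2 → F lam₁ ≤ F lam₂ := by
    intro x y hx hxy hy
    have hy1 : 1 < y := hx.trans_le hxy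
    have hv : 0 ≤ 1 / (y - 1) := (one_div_pos.mpr (sub_pos.mpr hy1)).le
    have hvu : 1 / (y - 1) ≤ 1 / (x - 1) :=
      one_div_le_one_div_of_le (sub_pos.mpr hx) (sub_le_sub_right hxy 1)
    rw [hF, hF, threshold_ratio_eq hx (hxy.trans_lt hy), threshold_ratio_eq hy1 hy,
      div_le_div_iff₀ (onePlusTwiceGeom_pos (hv.trans hvu) z) (onePlusTwiceGeom_pos hv z)]
    exact onePlusTwiceGeom_mul_le hv hvu ((Nat.sub_le k 1).trans hkz)
  exact ⟨hmono, fun E s hE hs x y hx hxy hy =>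
    mul_le_mul_of_nonneg_left (hmono x y hx hxy hy) (div_pos hE hs).le⟩
end
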